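/- Fix a stable allocation χ and define the sets p_d, q_d, r_d, s_d of agents and the sets R_d, S_d of items from χ as in the context. Then regardless of which stable allocation χ' we choose, every item in R_d is assigned by χ' to an agent in r_d, and every item in S_d is assigned by χ' to an agent in s_d. -/

import Mathlib

open Finset

/-- `χ` is a (partial) allocation of `m` indivisible items to `n` agents respecting `likes`:
whenever item `o` is assigned to agent `j`, agent `j` likes item `o`. -/
def IsAlloc {m n : ℕ} (likes : Fin n → Fin m → Prop) (χ : Fin m → Option (Fin n)) : Prop :=
  ∀ o j, χ o = some j → likes j o

/-- The profile of an allocation: agent `j` receives `prof χ j` items. -/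
def prof {m n : ℕ} (χ : Fin m → Option (Fin n)) (j : Fin n) : ℕ :=
  (Finset.univ.filter fun o => χ o = some j).card

/-- Utilitarian social welfare: the total number of allocated items. -/
def usw {m n : ℕ} (χ : Fin m → Option (Fin n)) : ℕ := ∑ j, prof χ j

/-- A max-USW allocation. -/
def MaxUSW {m n : ℕ} (likes : Fin n → Fin m → Prop) (χ : Fin m → Option (Fin n)) : Prop :=
  IsAlloc likes χ ∧ ∀ χ', IsAlloc likes χ' → usw χ' ≤ usw χ

/-- A transfer path in `χ` from agent `u` to agent `v`: pairwise distinct agents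
`a 0 = u, …, a k = v` (`k ≥ 1`) and items `o 0, …, o (k-1)` with `χ` assigning `o t` to
`a t` and agent `a (t+1)` liking `o t`. -/
def TransferPath {m n : ℕ} (likes : Fin n → Fin m → Prop) (χ : Fin m → Option (Fin n))
    (u v : Fin n) : Prop :=
  ∃ k : ℕ, 1 ≤ k ∧ ∃ a : Fin (k + 1) → Fin n, Function.Injective a ∧
    a 0 = u ∧ a (Fin.last k) = v ∧
    ∃ o : Fin k → Fin m, ∀ t : Fin k,
      χ (o t) = some (a t.castSucc) ∧ likes (a t.succ) (o t)

/-- `χ` admits a narrowing transfer: a transfer path from `u` to `v` with `h_u ≥ h_v + 2`. -/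
def Narrowing {m n : ℕ} (likes : Fin n → Fin m → Prop) (χ : Fin m → Option (Fin n)) : Prop :=
  ∃ u v, TransferPath likes χ u v ∧ prof χ v + 2 ≤ prof χ u

/-- A stable allocation: max-USW and admitting no narrowing transfer. -/
def Stable {m n : ℕ} (likes : Fin n → Fin m → Prop) (χ : Fin m → Option (Fin n)) : Prop :=
  MaxUSW likes χ ∧ ¬ Narrowing likes χ

/-- The profile of `χ` sorted in ascending order. -/
noncomputable def sortedProf {m n : ℕ} (χ : Fin m → Option (Fin n)) : Fin n → ℕ :=
  prof χ ∘ Tuple.sort (prof χ)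

/-- `pset likes χ d`: agents `i` with `h_i = d` admitting a transfer path in `χ` from `i`
to some agent `j` with `h_j = d - 1`. -/
def pset {m n : ℕ} (likes : Fin n → Fin m → Prop) (χ : Fin m → Option (Fin n)) (d : ℕ) :
    Set (Fin n) :=
  {i | prof χ i = d ∧ ∃ j, TransferPath likes χ i j ∧ prof χ j + 1 = d}

/-- `qset likes χ d`: agents `i` with `h_i = d` admitting a transfer path in `χ` from some
agent `k` with `h_k = d + 1` to `i`. -/
def qset {m n : ℕ} (likes : Fin n → Fin m → Prop) (χ : Fin m → Option (Fin n)) (d : ℕ) :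
    Set (Fin n) :=
  {i | prof χ i = d ∧ ∃ k, TransferPath likes χ k i ∧ prof χ k = d + 1}

/-- `rset likes χ d`: agents `i` with `h_i = d` belonging to neither `pset` nor `qset`. -/
def rset {m n : ℕ} (likes : Fin n → Fin m → Prop) (χ : Fin m → Option (Fin n)) (d : ℕ) :
    Set (Fin n) :=
  {i | prof χ i = d ∧ i ∉ pset likes χ d ∧ i ∉ qset likes χ d}

/-- `sset likes χ d = pset d ∪ qset (d-1)` (meaningful for `d ≥ 1`). -/
def sset {m n : ℕ} (likes : Fin n → Fin m → Prop) (χ : Fin m → Option (Fin n)) (d : ℕ) :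
    Set (Fin n) :=
  pset likes χ d ∪ qset likes χ (d - 1)

/-- `Envy likes χ u v`: agent `v` likes some item that `χ` assigns to agent `u`. -/
def Envy {m n : ℕ} (likes : Fin n → Fin m → Prop) (χ : Fin m → Option (Fin n))
    (u v : Fin n) : Prop :=
  ∃ o, χ o = some u ∧ likes v o

/-- A walk in a relation can be shortened to a walk without repeated vertices. -/
theorem Relation.ReflTransGen.exists_injOn_walk {α : Type*} {r : α → α → Prop} {u v : α}
    (h : Relation.ReflTransGen r u v) :
    ∃ (k : ℕ) (a : ℕ → α), Set.InjOn a (Set.Iic k) ∧ a 0 = u ∧ a k = v ∧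
      ∀ t < k, r (a t) (a (t + 1)) := by
  induction h using Relation.ReflTransGen.head_induction_on with
  | refl => exact ⟨0, fun _ => v, by intro x hx y hy _; simp_all, rfl, rfl, by simp⟩
  | @head x y hxy _ ih =>
    obtain ⟨k, a, hinj, h0, hk, hr⟩ := ih
    by_cases hx : ∃ t ≤ k, a t = x
    · obtain ⟨t, ht, rfl⟩ := hx
      refine ⟨k - t, fun s => a (s + t), ?_, by simp, by simp [ht, hk], ?_⟩
      · intro p hp q hq hpq
        simp only [Set.mem_Iic] at hp hq
        have := hinj (show p + t ≤ k by omega) (show q + t ≤ k by omega) hpq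
        omega
      · intro s hs
        have := hr (s + t) (by omega)
        rwa [show s + t + 1 = s + 1 + t by omega] at this
    · push Not at hx
      refine ⟨k + 1, fun s => Nat.casesOn s x a, ?_, rfl, hk, ?_⟩
      · rintro (_ | p) hp (_ | q) hq hpq
        · rfl
        · exact absurd hpq.symm (hx q (by simpa using hq))
        · exact absurd hpq (hx p (by simpa using hp))
        · exact congrArg (· + 1) (hinj (by simpa using hp) (by simpa using hq) hpq)
      · rintro (_ | t) ht
        · simpa [h0] using hxy
        · exact hr t (by omega)

theorem transferPath_iff {m n : ℕ} {likes : Fin n → Fin m → Prop}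
    {χ : Fin m → Option (Fin n)} {u v : Fin n} :
    TransferPath likes χ u v ↔ u ≠ v ∧ Relation.ReflTransGen (Envy likes χ) u v := by
  constructor
  · rintro ⟨k, hk, a, hinj, rfl, rfl, o, ho⟩
    refine ⟨fun h => ?_, ?_⟩
    · have := congrArg Fin.val (hinj h)
      simp at this
      omega
    · have key : ∀ t : Fin (k + 1), Relation.ReflTransGen (Envy likes χ) (a 0) (a t) := by
        intro t
        induction t using Fin.induction with
        | zero => exact .refl
        | succ t ih => exact ih.tail ⟨o t, ho t⟩
      exact key _
  · rintro ⟨hne, h⟩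
    obtain ⟨k, a, hinj, rfl, rfl, hr⟩ := h.exists_injOn_walk
    choose o ho using fun t : Fin k => hr t t.isLt
    refine ⟨k, ?_, fun t => a t, ?_, by simp, by simp, o, fun t => by simpa using ho t⟩
    · rcases Nat.eq_zero_or_pos k with rfl | hk
      · exact absurd rfl hne
      · exact hk
    · intro s t hst
      exact Fin.ext (hinj (Nat.lt_succ_iff.mp s.isLt) (Nat.lt_succ_iff.mp t.isLt) hst)

theorem sum_prof_eq_card {m n : ℕ} (χ : Fin m → Option (Fin n)) (B : Finset (Fin n)) :
    ∑ i ∈ B, prof χ i = #{o | ∃ i ∈ B, χ o = some i} := by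
  classical
  unfold prof
  rw [← card_biUnion]
  · congr 1
    ext o
    simp
  · intro i _ j _ hij
    refine disjoint_left.mpr fun o hi hj => hij ?_
    simp_all

/-- In a max-USW allocation every item that somebody likes is allocated. -/
theorem MaxUSW.exists_eq_some {m n : ℕ} {likes : Fin n → Fin m → Prop}
    {χ : Fin m → Option (Fin n)} (hχ : MaxUSW likes χ) {o : Fin m} {j : Fin n}
    (h : likes j o) : ∃ i, χ o = some i := by
  by_contra hno
  push Not at hno
  have hle := hχ.2 (Function.update χ o (some j)) (by
    intro o' i hi
    by_cases ho : o' = o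
    · subst ho
      simp_all
    · rw [Function.update_of_ne ho] at hi
      exact hχ.1 _ _ hi)
  refine absurd hle (not_le.mpr ?_)
  rw [usw, usw, sum_prof_eq_card, sum_prof_eq_card]
  refine card_lt_card (ssubset_iff_of_subset ?_ |>.mpr ⟨o, by simp, by simpa using hno⟩)
  intro o' ho'
  obtain ⟨i, -, hi⟩ := (mem_filter.mp ho').2
  have ho : o' ≠ o := by
    rintro rfl
    exact hno i hi
  simp [Function.update_of_ne ho, hi]

/-- If every item that `χ` assigns inside `B` is assigned inside `B` by `χ'` as well, and `χ'`
assigns a further item inside `B`, then some agent of `B` gets strictly more from `χ'`. -/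
theorem exists_prof_lt_prof {m n : ℕ} {χ χ' : Fin m → Option (Fin n)} {B : Set (Fin n)}
    (hB : ∀ o, ∀ i ∈ B, χ o = some i → ∃ i' ∈ B, χ' o = some i')
    {o : Fin m} {j : Fin n} (hj : j ∈ B) (ho' : χ' o = some j) (ho : ∀ i ∈ B, χ o ≠ some i) :
    ∃ u ∈ B, prof χ u < prof χ' u := by
  classical
  have hlt : ∑ i ∈ B.toFinset, prof χ i < ∑ i ∈ B.toFinset, prof χ' i := by
    rw [sum_prof_eq_card, sum_prof_eq_card]
    refine card_lt_card (ssubset_iff_of_subset ?_ |>.mpr ⟨o, ?_, ?_⟩)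
    · intro x hx
      obtain ⟨i, hi, hxi⟩ := (mem_filter.mp hx).2
      simpa using hB x i (by simpa using hi) hxi
    · simpa using ⟨j, hj, ho'⟩
    · simpa using ho
  obtain ⟨u, hu, h⟩ := exists_lt_of_sum_lt hlt
  exact ⟨u, by simpa using hu, h⟩

theorem Stable.prof_le_of_reflTransGen {m n : ℕ} {likes : Fin n → Fin m → Prop}
    {χ : Fin m → Option (Fin n)} (hχ : Stable likes χ) {u v : Fin n}
    (h : Relation.ReflTransGen (Envy likes χ) u v) : prof χ u ≤ prof χ v + 1 := by
  by_cases huv : u = v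
  · simp [huv]
  · by_contra hlt
    exact hχ.2 ⟨u, v, transferPath_iff.mpr ⟨huv, h⟩, by omega⟩

/-- Let `U` be a set of agents, each at least as well off in `χ` as every agent outside `U`, such
that nobody outside `U` likes an item held in `U`.  Then every other stable allocation assigns
the same items to `U`. -/
theorem Stable.mem_iff_mem {m n : ℕ} {likes : Fin n → Fin m → Prop}
    {χ χ' : Fin m → Option (Fin n)} (hχ : Stable likes χ) (hχ' : Stable likes χ')
    {U : Set (Fin n)} (hU : ∀ u ∈ U, ∀ v, Envy likes χ u v → v ∈ U)
    (hle : ∀ u ∈ U, ∀ v ∉ U, prof χ v ≤ prof χ u) {o : Fin m} {i i' : Fin n}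
    (ho : χ o = some i) (ho' : χ' o = some i') : i' ∈ U ↔ i ∈ U := by
  refine ⟨fun hi' => ?_, fun hi => hU i hi i' ⟨o, ho, hχ'.1.1 _ _ ho'⟩⟩
  by_contra hi
  let D : Fin n → Fin n → Prop := fun x y => ∃ o, χ' o = some x ∧ χ o = some y
  have hDU : ∀ x y, D x y → y ∈ U → x ∈ U := by
    rintro x y ⟨o, hx, hy⟩ h
    exact hU y h x ⟨o, hy, hχ'.1.1 _ _ hx⟩
  have hback : ∀ x y, Relation.ReflTransGen D x y → y ∈ U → x ∈ U := by
    intro x y hxy hy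
    induction hxy using Relation.ReflTransGen.head_induction_on with
    | refl => exact hy
    | head h _ ih => exact hDU _ _ h ih
  have hDE : ∀ x y, D x y → Envy likes χ' x y := by
    rintro x y ⟨o, hx, hy⟩
    exact ⟨o, hx, hχ.1.1 _ _ hy⟩
  obtain ⟨u, hu, hlu⟩ : ∃ u ∈ {x | Relation.ReflTransGen D x i'}, prof χ u < prof χ' u := by
    refine exists_prof_lt_prof ?_ (Relation.ReflTransGen.refl) ho' ?_
    · intro x y hy hxy
      obtain ⟨z, hz⟩ := hχ'.1.exists_eq_some (hχ.1.1 _ _ hxy)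
      exact ⟨z, Relation.ReflTransGen.head ⟨x, hz, hxy⟩ hy, hz⟩
    · intro x hx hox
      obtain rfl : i = x := Option.some.inj (ho.symm.trans hox)
      exact hi (hback _ _ hx hi')
  obtain ⟨v, hv, hlv⟩ : ∃ v ∈ {x | Relation.ReflTransGen D i x}, prof χ' v < prof χ v := by
    refine exists_prof_lt_prof ?_ (Relation.ReflTransGen.refl) ho ?_
    · intro x y hy hxy
      obtain ⟨z, hz⟩ := hχ.1.exists_eq_some (hχ'.1.1 _ _ hxy)
      exact ⟨z, Relation.ReflTransGen.tail hy ⟨x, hxy, hz⟩, hz⟩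
    · intro x hx hox
      obtain rfl : i' = x := Option.some.inj (ho'.symm.trans hox)
      exact hi (hback _ _ hx hi')
  have huv : Relation.ReflTransGen D u v :=
    (Relation.ReflTransGen.tail hu ⟨o, ho', ho⟩).trans hv
  have h1 := hχ'.prof_le_of_reflTransGen (Relation.ReflTransGen.mono hDE _ _ huv)
  have h2 := hle u (hback _ _ hu hi') v fun h => hi (hback _ _ hv h)
  omega

theorem Stable.disjoint_pset_qset {m n : ℕ} {likes : Fin n → Fin m → Prop}
    {χ : Fin m → Option (Fin n)} (hχ : Stable likes χ) (d : ℕ) :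
    Disjoint (pset likes χ d) (qset likes χ d) := by
  refine Set.disjoint_left.mpr ?_
  rintro i ⟨hi, j, hij, hj⟩ ⟨-, k, hki, hk⟩
  have := hχ.prof_le_of_reflTransGen
    ((transferPath_iff.mp hki).2.trans (transferPath_iff.mp hij).2)
  omega

/-- The position of an agent in the chain of layers `r 0, s 1, r 1, s 2, …`. -/
noncomputable def layer {m n : ℕ} (likes : Fin n → Fin m → Prop) (χ : Fin m → Option (Fin n))
    (i : Fin n) : ℕ :=
  open Classical in
  if i ∈ qset likes χ (prof χ i) then 2 * prof χ i + 1
  else if i ∈ pset likes χ (prof χ i) then 2 * prof χ i - 1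
  else 2 * prof χ i

theorem prof_pos_of_mem_pset {m n : ℕ} {likes : Fin n → Fin m → Prop}
    {χ : Fin m → Option (Fin n)} {i : Fin n} {d : ℕ} (h : i ∈ pset likes χ d) :
    0 < d := by
  obtain ⟨-, j, -, hj⟩ := h
  omega

theorem mem_rset_iff_layer {m n : ℕ} {likes : Fin n → Fin m → Prop}
    {χ : Fin m → Option (Fin n)} {i : Fin n} {d : ℕ} :
    i ∈ rset likes χ d ↔ layer likes χ i = 2 * d := by
  have hpos := @prof_pos_of_mem_pset m n likes χ i (prof χ i)
  unfold layer
  constructor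
  · rintro ⟨rfl, hp, hq⟩
    simp [hp, hq]
  · intro h
    split_ifs at h with hq hp
    · omega
    · have := hpos hp
      omega
    · obtain rfl : prof χ i = d := by omega
      exact ⟨rfl, hp, hq⟩

theorem Stable.mem_sset_iff_layer {m n : ℕ} {likes : Fin n → Fin m → Prop}
    {χ : Fin m → Option (Fin n)} (hχ : Stable likes χ) {i : Fin n} {d : ℕ} (hd : 1 ≤ d) :
    i ∈ sset likes χ d ↔ layer likes χ i + 1 = 2 * d := by
  have hpos := @prof_pos_of_mem_pset m n likes χ i (prof χ i)
  unfold layer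
  constructor
  · rintro (hp | hq)
    · obtain rfl : prof χ i = d := hp.1
      rw [if_neg (Set.disjoint_left.mp (hχ.disjoint_pset_qset _) hp), if_pos hp]
      omega
    · obtain h : prof χ i = d - 1 := hq.1
      rw [if_pos (h ▸ hq)]
      omega
  · intro h
    split_ifs at h with hq hp
    · obtain h' : prof χ i = d - 1 := by omega
      exact Or.inr (h' ▸ hq)
    · have := hpos hp
      obtain rfl : prof χ i = d := by omega
      exact Or.inl hp
    · omega

theorem layer_bounds {m n : ℕ} (likes : Fin n → Fin m → Prop) (χ : Fin m → Option (Fin n))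
    (i : Fin n) :
    2 * prof χ i ≤ layer likes χ i + 1 ∧ layer likes χ i ≤ 2 * prof χ i + 1 := by
  unfold layer
  split_ifs <;> omega

theorem Stable.layer_le_layer {m n : ℕ} {likes : Fin n → Fin m → Prop}
    {χ : Fin m → Option (Fin n)} (hχ : Stable likes χ) {u v : Fin n}
    (h : Envy likes χ u v) : layer likes χ u ≤ layer likes χ v := by
  have huv : Relation.ReflTransGen (Envy likes χ) u v := .single h
  have hle := hχ.prof_le_of_reflTransGen huv
  have path : ∀ {x y}, Relation.ReflTransGen (Envy likes χ) x y → prof χ x ≠ prof χ y →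
      TransferPath likes χ x y := fun hxy hne =>
    transferPath_iff.mpr ⟨fun e => hne (congrArg _ e), hxy⟩
  have hdisj := Set.disjoint_left.mp (hχ.disjoint_pset_qset (prof χ u))
  rcases (show prof χ u = prof χ v + 1 ∨ prof χ u = prof χ v ∨ prof χ u < prof χ v by omega)
    with e | e | e
  · have hp : u ∈ pset likes χ (prof χ u) := ⟨rfl, v, path huv (by omega), e.symm⟩
    have hq : v ∈ qset likes χ (prof χ v) := ⟨rfl, u, path huv (by omega), e⟩
    rw [layer, layer, if_neg (hdisj hp), if_pos hp, if_pos hq]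
    omega
  · have hq : u ∈ qset likes χ (prof χ u) → v ∈ qset likes χ (prof χ v) := by
      rintro ⟨-, k, hk, hk'⟩
      exact ⟨rfl, k, path ((transferPath_iff.mp hk).2.trans huv) (by omega), by omega⟩
    have hp : v ∈ pset likes χ (prof χ v) → u ∈ pset likes χ (prof χ u) := by
      rintro ⟨-, k, hk, hk'⟩
      exact ⟨rfl, k, path (huv.trans (transferPath_iff.mp hk).2) (by omega), by omega⟩
    unfold layer
    split_ifs <;> first | omega | tauto
  · have := layer_bounds likes χ u
    have := layer_bounds likes χ v
    omega

/-- Every item is held in the same layer in all stable allocations. -/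
theorem Stable.layer_eq_layer {m n : ℕ} {likes : Fin n → Fin m → Prop}
    {χ χ' : Fin m → Option (Fin n)} (hχ : Stable likes χ) (hχ' : Stable likes χ')
    {o : Fin m} {i i' : Fin n} (ho : χ o = some i) (ho' : χ' o = some i') :
    layer likes χ i' = layer likes χ i := by
  have key : ∀ L, L ≤ layer likes χ i' ↔ L ≤ layer likes χ i := by
    intro L
    refine hχ.mem_iff_mem hχ' (U := {x | L ≤ layer likes χ x}) ?_ ?_ ho ho'
    · intro u hu v huv
      exact le_trans hu (hχ.layer_le_layer huv)
    · intro u hu v hv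
      have h1 := layer_bounds likes χ u
      have h2 := layer_bounds likes χ v
      simp only [Set.mem_ofPred_eq] at hu hv
      omega
  exact le_antisymm ((key _).mp le_rfl) ((key _).mpr le_rfl)

/-- fix a stable allocation `χ` and define `r_d, s_d` (sets of agents) and the
item sets `R_d, S_d` (items `χ` assigns to `r_d`, resp. `s_d`) from `χ`.  Then in every
stable allocation `χ'`, each item of `R_d` is assigned to an agent of `r_d`, and each item
of `S_d` (for `d ≥ 1`) is assigned to an agent of `s_d`. -/
theorem layer_items_invariant {m n : ℕ} (likes : Fin n → Fin m → Prop)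
    (χ : Fin m → Option (Fin n)) (hχ : Stable likes χ)
    (χ' : Fin m → Option (Fin n)) (hχ' : Stable likes χ') (d : ℕ) :
    (∀ o i, χ o = some i → i ∈ rset likes χ d →
      ∃ i', χ' o = some i' ∧ i' ∈ rset likes χ d) ∧
    (1 ≤ d → ∀ o i, χ o = some i → i ∈ sset likes χ d →
      ∃ i', χ' o = some i' ∧ i' ∈ sset likes χ d) := by
  have key : ∀ o i, χ o = some i →
      ∃ i', χ' o = some i' ∧ layer likes χ i' = layer likes χ i := by
    intro o i ho
    obtain ⟨i', ho'⟩ := hχ'.1.exists_eq_some (hχ.1.1 _ _ ho)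
    exact ⟨i', ho', hχ.layer_eq_layer hχ' ho ho'⟩
  refine ⟨fun o i ho hi => ?_, fun hd o i ho hi => ?_⟩
  · obtain ⟨i', ho', h⟩ := key o i ho
    exact ⟨i', ho', mem_rset_iff_layer.mpr (h.trans (mem_rset_iff_layer.mp hi))⟩
  · obtain ⟨i', ho', h⟩ := key o i ho
    refine ⟨i', ho', (hχ.mem_sset_iff_layer hd).mpr ?_⟩
    rw [h]
    exact (hχ.mem_sset_iff_layer hd).mp hi
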